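/- Let β > 0 and define V(x, y) = 1 + ∫₀^∞ 4β e^{−4βu} erf((x+y)/(2√(2u))) · erf((y−x)/(2√(2u))) du for −∞ < x ≤ y ≤ 0. Then V satisfies (∂ₓ² + ∂_y²)V − 4βV = 0 on {x < y < 0}, V(x, x) = 1 for x < 0, and ∂_y V(x, y)|_{y=0} = 0 for x < 0. -/

import Mathlib

open Real Set MeasureTheory

noncomputable def erf (x : ℝ) : ℝ := (2 / Real.sqrt π) * ∫ t in (0:ℝ)..x, Real.exp (-t^2)

noncomputable def Vhalf (β x y : ℝ) : ℝ :=
  1 + ∫ u in Ioi (0:ℝ),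
    4 * β * Real.exp (-(4*β*u)) * erf ((x+y) / (2 * Real.sqrt (2*u)))
      * erf ((y-x) / (2 * Real.sqrt (2*u)))

open Filter Topology

noncomputable def gD (t : ℝ) : ℝ := 2 / Real.sqrt π * Real.exp (-t^2)

lemma erf_hasDerivAt (x : ℝ) : HasDerivAt erf (gD x) x := by
  unfold erf gD
  apply HasDerivAt.const_mul
  have hc : Continuous (fun t : ℝ => Real.exp (-t^2)) := by fun_prop
  exact intervalIntegral.integral_hasDerivAt_right (hc.intervalIntegrable _ _)
    (hc.stronglyMeasurableAtFilter _ _) hc.continuousAt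

lemma gD_hasDerivAt (x : ℝ) : HasDerivAt gD (-2 * x * gD x) x := by
  unfold gD
  have h : HasDerivAt (fun t : ℝ => -t^2) (-(2*x)) x := by
    simpa using (hasDerivAt_pow 2 x).fun_neg
  refine ((h.exp).const_mul (2 / Real.sqrt π)).congr_deriv ?_
  ring

lemma erf_cont : Continuous erf :=
  continuous_iff_continuousAt.2 fun x => (erf_hasDerivAt x).continuousAt

lemma gD_cont : Continuous gD :=
  continuous_iff_continuousAt.2 fun x => (gD_hasDerivAt x).continuousAt

lemma gD_nonneg (x : ℝ) : 0 ≤ gD x := by unfold gD; positivity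

lemma c_le : 2 / Real.sqrt π ≤ 2 := by
  apply div_le_self (by norm_num)
  rw [Real.one_le_sqrt]
  linarith [Real.pi_gt_three]

lemma gD_le (x : ℝ) : gD x ≤ 2 := by
  unfold gD
  have h1 : Real.exp (-x^2) ≤ 1 := Real.exp_le_one_iff.2 (by nlinarith [sq_nonneg x])
  have := c_le
  have h0 : 0 ≤ 2 / Real.sqrt π := by positivity
  nlinarith [Real.exp_pos (-x^2)]

lemma sq_gD_le (x : ℝ) : (1 + x^2) * gD x ≤ 2 := by
  unfold gD
  have h1 : (1 + x^2) * Real.exp (-x^2) ≤ 1 := by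
    rw [Real.exp_neg, ← div_eq_mul_inv, div_le_one (Real.exp_pos _)]
    linarith [Real.add_one_le_exp (x^2)]
  have := c_le
  have h0 : 0 ≤ 2 / Real.sqrt π := by positivity
  calc _ = 2 / Real.sqrt π * ((1 + x^2) * Real.exp (-x^2)) := by ring
    _ ≤ 2 / Real.sqrt π * 1 := by gcongr
    _ ≤ 2 := by linarith

lemma abs_gD_le (x : ℝ) : |x| * gD x ≤ 2 := by
  refine le_trans ?_ (sq_gD_le x)
  apply mul_le_mul_of_nonneg_right _ (gD_nonneg x)
  nlinarith [sq_abs x, sq_nonneg (|x| - 1), abs_nonneg x]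

lemma erf_zero : erf 0 = 0 := by simp [erf]

lemma erf_neg (x : ℝ) : erf (-x) = - erf x := by
  unfold erf
  have := intervalIntegral.integral_comp_neg (a := 0) (b := x) (fun t : ℝ => Real.exp (-t^2))
  simp only [neg_sq, neg_zero] at this
  rw [this, intervalIntegral.integral_symm 0 (-x)]
  ring_nf

lemma erf_mono : Monotone erf :=
  monotone_of_deriv_nonneg (fun x => (erf_hasDerivAt x).differentiableAt)
    fun x => by rw [(erf_hasDerivAt x).deriv]; exact gD_nonneg x

lemma erf_top : Tendsto erf atTop (𝓝 1) := by
  have hi : Integrable (fun t : ℝ => Real.exp (-t^2)) := by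
    simpa using integrable_exp_neg_mul_sq (b := 1) one_pos
  have h := (intervalIntegral_tendsto_integral_Ioi 0 hi.integrableOn tendsto_id).const_mul
    (2 / Real.sqrt π)
  have h2 := integral_gaussian_Ioi 1
  simp only [neg_mul, one_mul, div_one] at h2
  rw [h2] at h
  have h3 : 2 / Real.sqrt π * (Real.sqrt π / 2) = 1 := by
    have : Real.sqrt π ≠ 0 := by positivity
    field_simp
  rw [h3] at h
  exact h

lemma erf_bot : Tendsto erf atBot (𝓝 (-1)) := by
  have := (erf_top.comp tendsto_neg_atBot_atTop).neg
  refine this.congr fun x => ?_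
  simp [erf_neg]

lemma erf_abs_le (x : ℝ) : |erf x| ≤ 1 :=
  abs_le.2 ⟨erf_mono.le_of_tendsto erf_bot x, erf_mono.ge_of_tendsto erf_top x⟩

noncomputable def rr (u : ℝ) : ℝ := (2 * Real.sqrt (2*u))⁻¹

lemma rr_meas : Measurable rr := by unfold rr; fun_prop

lemma rr_nonneg (u : ℝ) : 0 ≤ rr u := by unfold rr; positivity

lemma rr_sq {u : ℝ} (hu : 0 < u) : rr u ^ 2 = 1 / (8 * u) := by
  unfold rr
  rw [inv_pow, mul_pow, Real.sq_sqrt (by positivity)]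
  field_simp
  norm_num

lemma rr_hasDerivAt {u : ℝ} (hu : 0 < u) : HasDerivAt rr (-4 * rr u ^ 3) u := by
  have h1 : HasDerivAt (fun u : ℝ => 2 * u) 2 u := by simpa using (hasDerivAt_id u).const_mul 2
  have h2 := ((h1.sqrt (by positivity)).const_mul 2).inv (by positivity)
  refine h2.congr_deriv ?_
  unfold rr
  have h3 : Real.sqrt (2*u) ^ 2 = 2 * u := Real.sq_sqrt (by positivity)
  have h4 : 0 < Real.sqrt (2*u) := by positivity
  field_simp
  norm_num

lemma rr_zero : Tendsto rr (𝓝[>] 0) atTop := by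
  unfold rr
  apply Tendsto.inv_tendsto_nhdsGT_zero
  apply tendsto_nhdsWithin_of_tendsto_nhds_of_eventually_within
  · have : Continuous (fun u : ℝ => 2 * Real.sqrt (2*u)) := by fun_prop
    have h := (this.tendsto 0).mono_left (nhdsWithin_le_nhds (s := Ioi 0))
    simpa using h
  · filter_upwards [self_mem_nhdsWithin] with u hu
    have : (0:ℝ) < u := hu
    simp only [mem_Ioi]; positivity

noncomputable def ww (β u : ℝ) : ℝ := 4 * β * Real.exp (-(4*β*u))

lemma ww_nonneg {β : ℝ} (hβ : 0 < β) (u : ℝ) : 0 ≤ ww β u := by unfold ww; positivity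

lemma ww_meas (β : ℝ) : Measurable (ww β) := by unfold ww; fun_prop

lemma ww_int {β : ℝ} (hβ : 0 < β) : IntegrableOn (ww β) (Ioi 0) := by
  have := (integrableOn_exp_mul_Ioi (a := -(4*β)) (by linarith) 0).const_mul (4*β)
  change IntegrableOn (fun u => 4 * β * Real.exp (-(4*β*u))) (Ioi 0)
  simpa [IntegrableOn] using this

lemma wr_int {β : ℝ} (hβ : 0 < β) : IntegrableOn (fun u => ww β u * rr u) (Ioi 0) := by
  have := (integrableOn_rpow_mul_exp_neg_mul_rpow (s := -1/2) (p := 1) (b := 4*β)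
    (by norm_num) (by norm_num) (by linarith)).const_mul (4*β*(2 * Real.sqrt 2)⁻¹)
  refine IntegrableOn.congr_fun this ?_ measurableSet_Ioi
  intro u hu
  have hu : (0:ℝ) < u := hu
  simp only [ww, rr, Real.rpow_one]
  rw [Real.sqrt_mul (by norm_num), show (-1/2 : ℝ) = -(1/2) by norm_num, Real.rpow_neg hu.le,
    ← Real.sqrt_eq_rpow]
  rw [mul_inv, mul_inv, mul_inv]
  ring_nf

noncomputable def F0 (u x y : ℝ) : ℝ := erf ((x+y) * rr u) * erf ((y-x) * rr u)

noncomputable def F1 (u x y : ℝ) : ℝ :=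
  rr u * (gD ((x+y) * rr u) * erf ((y-x) * rr u) - erf ((x+y) * rr u) * gD ((y-x) * rr u))

noncomputable def F2 (u x y : ℝ) : ℝ :=
  rr u ^ 2 * (-2 * ((x+y) * rr u) * gD ((x+y) * rr u) * erf ((y-x) * rr u)
    - 2 * gD ((x+y) * rr u) * gD ((y-x) * rr u)
    - 2 * ((y-x) * rr u) * erf ((x+y) * rr u) * gD ((y-x) * rr u))

lemma F0_deriv (u x y : ℝ) : HasDerivAt (fun x => F0 u x y) (F1 u x y) x := by
  have ha : HasDerivAt (fun x => (x+y) * rr u) (rr u) x := by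
    simpa using ((hasDerivAt_id x).add_const y).mul_const (rr u)
  have hb : HasDerivAt (fun x => (y-x) * rr u) (-rr u) x := by
    simpa using ((hasDerivAt_id x).const_sub y).mul_const (rr u)
  refine (((erf_hasDerivAt _).comp x ha).mul ((erf_hasDerivAt _).comp x hb)).congr_deriv ?_
  simp only [F1, Function.comp]; ring

lemma F1_deriv (u x y : ℝ) : HasDerivAt (fun x => F1 u x y) (F2 u x y) x := by
  have ha : HasDerivAt (fun x => (x+y) * rr u) (rr u) x := by
    simpa using ((hasDerivAt_id x).add_const y).mul_const (rr u)
  have hb : HasDerivAt (fun x => (y-x) * rr u) (-rr u) x := by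
    simpa using ((hasDerivAt_id x).const_sub y).mul_const (rr u)
  refine (((((gD_hasDerivAt _).comp x ha).mul ((erf_hasDerivAt _).comp x hb)).sub
    (((erf_hasDerivAt _).comp x ha).mul ((gD_hasDerivAt _).comp x hb))).const_mul
      (rr u)).congr_deriv ?_
  simp only [F2, Function.comp]; ring

lemma F0_meas (x y : ℝ) : Measurable (fun u => F0 u x y) := by
  have := rr_meas; have := erf_cont.measurable
  unfold F0; fun_prop

lemma F1_meas (x y : ℝ) : Measurable (fun u => F1 u x y) := by
  have := rr_meas; have := erf_cont.measurable; have := gD_cont.measurable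
  unfold F1; fun_prop

lemma F2_meas (x y : ℝ) : Measurable (fun u => F2 u x y) := by
  have := rr_meas; have := erf_cont.measurable; have := gD_cont.measurable
  unfold F2; fun_prop

lemma F0_le (u x y : ℝ) : |F0 u x y| ≤ 1 := by
  unfold F0; rw [abs_mul]
  exact mul_le_one₀ (erf_abs_le _) (abs_nonneg _) (erf_abs_le _)

lemma F1_le (u x y : ℝ) : |F1 u x y| ≤ 4 * rr u := by
  unfold F1; rw [abs_mul, abs_of_nonneg (rr_nonneg u), mul_comm]
  apply mul_le_mul_of_nonneg_right _ (rr_nonneg u)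
  refine (abs_sub _ _).trans ?_
  rw [abs_mul, abs_mul, abs_of_nonneg (gD_nonneg _), abs_of_nonneg (gD_nonneg _)]
  nlinarith [gD_le ((x+y) * rr u), gD_le ((y-x) * rr u), gD_nonneg ((x+y) * rr u),
    gD_nonneg ((y-x) * rr u), erf_abs_le ((x+y) * rr u), erf_abs_le ((y-x) * rr u)]

lemma r_gD_le (u a δ : ℝ) (hδ : 0 < δ) (ha : δ ≤ |a|) : rr u * gD (a * rr u) ≤ 2 / δ := by
  rw [le_div_iff₀ hδ]
  have h := abs_gD_le (a * rr u)
  rw [abs_mul, abs_of_nonneg (rr_nonneg u)] at h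
  have := mul_nonneg (rr_nonneg u) (gD_nonneg (a * rr u))
  nlinarith

lemma r_agD_le (u a δ : ℝ) (hδ : 0 < δ) (ha : δ ≤ |a|) :
    rr u * (|a * rr u| * gD (a * rr u)) ≤ 2 / δ := by
  rw [le_div_iff₀ hδ]
  have h := sq_gD_le (a * rr u)
  have h1 := gD_nonneg (a * rr u)
  rw [← sq_abs] at h
  rw [abs_mul, abs_of_nonneg (rr_nonneg u)] at *
  have := mul_nonneg (mul_nonneg (rr_nonneg u) (rr_nonneg u)) (mul_nonneg (abs_nonneg a) h1)
  nlinarith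

lemma F2_le (u x y δ : ℝ) (hδ : 0 < δ) (ha : δ ≤ |x+y|) (hb : δ ≤ |y-x|) :
    |F2 u x y| ≤ 16 / δ * rr u := by
  have hr := rr_nonneg u
  have e : F2 u x y = rr u * (-2 * (rr u * (((x+y) * rr u) * gD ((x+y) * rr u)) * erf ((y-x) * rr u))
    - 2 * (rr u * gD ((x+y) * rr u) * gD ((y-x) * rr u))
    - 2 * (rr u * (((y-x) * rr u) * gD ((y-x) * rr u)) * erf ((x+y) * rr u))) := by
    unfold F2; ring
  rw [e, abs_mul, abs_of_nonneg hr, mul_comm]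
  apply mul_le_mul_of_nonneg_right _ hr
  have key : ∀ p q : ℝ, δ ≤ |p| →
      |rr u * ((p * rr u) * gD (p * rr u)) * erf q| ≤ 2 / δ := by
    intro p q hp
    rw [abs_mul, abs_mul, abs_mul (p * rr u), abs_of_nonneg hr, abs_of_nonneg (gD_nonneg _)]
    exact (mul_le_of_le_one_right (by have := gD_nonneg (p * rr u); positivity)
      (erf_abs_le _)).trans (r_agD_le u p δ hδ hp)
  have k1 := abs_le.1 (key _ ((y-x) * rr u) ha)
  have k2 := abs_le.1 (key _ ((x+y) * rr u) hb)
  have k3 : rr u * gD ((x+y) * rr u) * gD ((y-x) * rr u) ≤ 2 / δ * 2 :=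
    mul_le_mul (r_gD_le u _ δ hδ ha) (gD_le _) (gD_nonneg _) (by positivity)
  have k4 : 0 ≤ rr u * gD ((x+y) * rr u) * gD ((y-x) * rr u) :=
    mul_nonneg (mul_nonneg hr (gD_nonneg _)) (gD_nonneg _)
  have e16 : 16 / δ = 8 * (2 / δ) := by ring
  have : 0 < 2 / δ := by positivity
  rw [e16, abs_le]
  constructor <;> linarith [k1.1, k1.2, k2.1, k2.2]

noncomputable def G (β x y : ℝ) : ℝ := ∫ u in Ioi (0:ℝ), ww β u * F0 u x y

lemma Vhalf_eq (β x y : ℝ) : Vhalf β x y = 1 + G β x y := by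
  unfold Vhalf G ww F0 rr
  simp only [div_eq_mul_inv, mul_assoc]

lemma F0_swap (u x y : ℝ) : F0 u x y = - F0 u y x := by
  unfold F0
  rw [show (y - x) * rr u = -((x-y) * rr u) by ring, erf_neg, add_comm]; ring

lemma G_swap (β x y : ℝ) : G β x y = - G β y x := by
  unfold G
  rw [← integral_neg]
  congr 1; ext u
  rw [F0_swap]; ring

lemma wF0_int {β : ℝ} (hβ : 0 < β) (x y : ℝ) :
    IntegrableOn (fun u => ww β u * F0 u x y) (Ioi 0) := by
  refine Integrable.mono' (ww_int hβ) ((ww_meas β).mul (F0_meas x y)).aestronglyMeasurable ?_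
  refine .of_forall fun u => ?_
  rw [Real.norm_eq_abs, abs_mul, abs_of_nonneg (ww_nonneg hβ u)]
  exact mul_le_of_le_one_right (ww_nonneg hβ u) (F0_le _ _ _)

lemma bnd {β : ℝ} (hβ : 0 < β) (u f C : ℝ) (h : |f| ≤ C * rr u) :
    ‖ww β u * f‖ ≤ C * (ww β u * rr u) := by
  rw [Real.norm_eq_abs, abs_mul, abs_of_nonneg (ww_nonneg hβ u)]
  calc _ ≤ ww β u * (C * rr u) := mul_le_mul_of_nonneg_left h (ww_nonneg hβ u)
    _ = _ := by ring

lemma wF1_int {β : ℝ} (hβ : 0 < β) (x y : ℝ) :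
    IntegrableOn (fun u => ww β u * F1 u x y) (Ioi 0) :=
  Integrable.mono' ((wr_int hβ).const_mul 4)
    ((ww_meas β).mul (F1_meas x y)).aestronglyMeasurable
    (.of_forall fun u => bnd hβ u _ _ (F1_le u x y))

lemma wF2_int {β : ℝ} (hβ : 0 < β) (x y δ : ℝ) (hδ : 0 < δ) (ha : δ ≤ |x+y|) (hb : δ ≤ |y-x|) :
    IntegrableOn (fun u => ww β u * F2 u x y) (Ioi 0) :=
  Integrable.mono' ((wr_int hβ).const_mul (16/δ))
    ((ww_meas β).mul (F2_meas x y)).aestronglyMeasurable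
    (.of_forall fun u => bnd hβ u _ _ (F2_le u x y δ hδ ha hb))

lemma G_deriv {β : ℝ} (hβ : 0 < β) (x y : ℝ) :
    HasDerivAt (fun x => G β x y) (∫ u in Ioi (0:ℝ), ww β u * F1 u x y) x := by
  refine (hasDerivAt_integral_of_dominated_loc_of_deriv_le (s := univ)
    (F := fun x u => ww β u * F0 u x y) (F' := fun x u => ww β u * F1 u x y)
    (bound := fun u => 4 * (ww β u * rr u)) univ_mem ?_ (wF0_int hβ x y) ?_ ?_ ?_ ?_).2
  · exact .of_forall fun x => ((ww_meas β).mul (F0_meas x y)).aestronglyMeasurable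
  · exact ((ww_meas β).mul (F1_meas x y)).aestronglyMeasurable
  · exact .of_forall fun u x _ => bnd hβ u _ _ (F1_le u x y)
  · exact (wr_int hβ).const_mul 4
  · exact .of_forall fun u x _ => (F0_deriv u x y).const_mul _

lemma G_deriv2 {β : ℝ} (hβ : 0 < β) (x y δ : ℝ) (hδ : 0 < δ) (ha : 2*δ ≤ |x+y|)
    (hb : 2*δ ≤ |y-x|) :
    deriv (deriv (fun x => G β x y)) x = ∫ u in Ioi (0:ℝ), ww β u * F2 u x y := by
  have h1 : deriv (fun x => G β x y) = fun x => ∫ u in Ioi (0:ℝ), ww β u * F1 u x y :=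
    funext fun x => (G_deriv hβ x y).deriv
  rw [h1]
  refine HasDerivAt.deriv (hasDerivAt_integral_of_dominated_loc_of_deriv_le
    (s := Metric.ball x δ)
    (F := fun x u => ww β u * F1 u x y) (F' := fun x u => ww β u * F2 u x y)
    (bound := fun u => 16/δ * (ww β u * rr u)) (Metric.ball_mem_nhds x hδ) ?_
      (wF1_int hβ x y) ?_ ?_ ?_ ?_).2
  · exact .of_forall fun x => ((ww_meas β).mul (F1_meas x y)).aestronglyMeasurable
  · exact ((ww_meas β).mul (F2_meas x y)).aestronglyMeasurable
  · refine .of_forall fun u z hz => bnd hβ u _ _ (F2_le u z y δ hδ ?_ ?_)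
    · rw [Metric.mem_ball, Real.dist_eq] at hz
      have := abs_sub_abs_le_abs_sub (x+y) (z+y)
      rw [show x + y - (z+y) = -(z-x) by ring, abs_neg] at this
      linarith
    · rw [Metric.mem_ball, Real.dist_eq] at hz
      have := abs_sub_abs_le_abs_sub (y-x) (y-z)
      rw [show y - x - (y-z) = z-x by ring] at this
      linarith
  · exact (wr_int hβ).const_mul _
  · exact .of_forall fun u x _ => (F1_deriv u x y).const_mul _

lemma F0_deriv_u {u : ℝ} (hu : 0 < u) (x y : ℝ) :
    HasDerivAt (fun u => F0 u x y) (F2 u x y - F2 u y x) u := by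
  have ha := (rr_hasDerivAt hu).const_mul (x+y)
  have hb := (rr_hasDerivAt hu).const_mul (y-x)
  refine (((erf_hasDerivAt _).comp u ha).mul ((erf_hasDerivAt _).comp u hb)).congr_deriv ?_
  have hg : gD ((x-y) * rr u) = gD ((y-x) * rr u) := by unfold gD; congr 2; ring
  have he : erf ((x-y) * rr u) = - erf ((y-x) * rr u) := by rw [← erf_neg]; congr 1; ring
  simp only [F2, Function.comp, add_comm y x, hg, he]; ring

lemma ww_deriv (β u : ℝ) : HasDerivAt (ww β) (-(4*β) * ww β u) u := by
  have h : HasDerivAt (fun u : ℝ => -(4*β*u)) (-(4*β)) u := by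
    simpa using ((hasDerivAt_id u).const_mul (4*β)).fun_neg
  refine (h.exp.const_mul (4*β)).congr_deriv ?_
  unfold ww; ring

lemma F0_zero (x y : ℝ) (h1 : x + y < 0) (h2 : 0 < y - x) :
    Tendsto (fun u => F0 u x y) (𝓝[>] 0) (𝓝 (-1)) := by
  have ha := erf_bot.comp (rr_zero.const_mul_atTop_of_neg h1)
  have hb := erf_top.comp (rr_zero.const_mul_atTop h2)
  change Tendsto (fun u => erf ((x+y) * rr u) * erf ((y-x) * rr u)) _ _
  simpa using ha.mul hb

lemma main_id {β : ℝ} (hβ : 0 < β) (x y δ : ℝ) (hδ : 0 < δ) (h1 : x + y < 0) (h2 : 0 < y - x)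
    (ha : δ ≤ |x+y|) (hb : δ ≤ |y-x|) :
    (∫ u in Ioi (0:ℝ), ww β u * F2 u x y) - (∫ u in Ioi (0:ℝ), ww β u * F2 u y x)
      = 4 * β * (1 + G β x y) := by
  have i1 := wF2_int hβ x y δ hδ ha hb
  have i2 := wF2_int hβ y x δ hδ (by rwa [add_comm]) (by rwa [abs_sub_comm])
  have i12 : IntegrableOn (fun u => ww β u * (F2 u x y - F2 u y x)) (Ioi 0) := by
    simp only [mul_sub]
    exact i1.sub i2
  have i0 : IntegrableOn (fun u => -(4*β) * ww β u * F0 u x y) (Ioi 0) := by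
    simp only [mul_assoc]
    exact (wF0_int hβ x y).const_mul (-(4*β))
  have hz : Tendsto (ww β * fun u => F0 u x y) (𝓝[>] 0) (𝓝 (-(4*β))) := by
    have hw : Tendsto (ww β) (𝓝[>] 0) (𝓝 (4*β)) := by
      have := ((ww_deriv β 0).continuousAt.tendsto).mono_left (nhdsWithin_le_nhds (s := Ioi 0))
      simpa [ww] using this
    change Tendsto (fun u => ww β u * F0 u x y) _ _
    simpa using hw.mul (F0_zero x y h1 h2)
  have hi : Tendsto (ww β * fun u => F0 u x y) atTop (𝓝 0) := by
    have hw : Tendsto (ww β) atTop (𝓝 0) := by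
      have : Tendsto (fun u : ℝ => 4*β*u) atTop atTop :=
        tendsto_id.const_mul_atTop (by positivity)
      change Tendsto (fun u => 4 * β * Real.exp (-(4*β*u))) _ _
      simpa using (Real.tendsto_exp_neg_atTop_nhds_zero.comp this).const_mul (4*β)
    refine squeeze_zero_norm (fun u => ?_) hw
    simp only [Pi.mul_apply]
    rw [Real.norm_eq_abs, abs_mul, abs_of_nonneg (ww_nonneg hβ u)]
    exact mul_le_of_le_one_right (ww_nonneg hβ u) (F0_le _ _ _)
  have key := integral_Ioi_mul_deriv_eq_deriv_mul (fun u _ => ww_deriv β u)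
    (fun u hu => F0_deriv_u (mem_Ioi.1 hu) x y) i12 i0 hz hi
  rw [← integral_sub i1 i2]
  simp only [← mul_sub]
  rw [key]
  simp only [mul_assoc]
  rw [integral_const_mul]
  unfold G
  ring

theorem halfline_parity_bvp (β : ℝ) (hβ : 0 < β) :
    (∀ x y : ℝ, x < y → y < 0 →
      deriv (deriv (fun x' : ℝ => Vhalf β x' y)) x
        + deriv (deriv (fun y' : ℝ => Vhalf β x y')) y
        - 4 * β * Vhalf β x y = 0) ∧
    (∀ x : ℝ, x < 0 → Vhalf β x x = 1) ∧
    (∀ x : ℝ, x < 0 → deriv (fun y' : ℝ => Vhalf β x y') 0 = 0) := by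
  simp only [Vhalf_eq]
  refine ⟨fun x y hxy hy => ?_, fun x _ => ?_, fun x _ => ?_⟩
  · obtain ⟨δ, hδ, ha, hb⟩ : ∃ δ : ℝ, 0 < δ ∧ 2*δ ≤ |x+y| ∧ 2*δ ≤ |y-x| := by
      have h1 : 0 < |x+y| := abs_pos.2 (by linarith)
      have h2 : 0 < |y-x| := abs_pos.2 (by linarith)
      refine ⟨min |x+y| |y-x| / 2, by positivity, ?_, ?_⟩
      · linarith [min_le_left |x+y| |y-x|]
      · linarith [min_le_right |x+y| |y-x|]
    have e1 : deriv (fun x' => 1 + G β x' y) = deriv (fun x' => G β x' y) := by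
      ext z; exact deriv_const_add _
    have e2 : deriv (fun y' => 1 + G β x y') = fun z => - deriv (fun y' => G β y' x) z := by
      ext z
      rw [deriv_const_add, ← deriv.fun_neg]
      congr 1; ext w; exact G_swap β x w
    rw [e1, e2, deriv.fun_neg, G_deriv2 hβ x y δ hδ ha hb,
      G_deriv2 hβ y x δ hδ (by rwa [add_comm]) (by rwa [abs_sub_comm])]
    have := main_id hβ x y δ hδ (by linarith) (by linarith) (by linarith) (by linarith)
    linarith
  · have : G β x x = 0 := by simp [G, F0, erf_zero]
    rw [this, add_zero]
  · have hev : ∀ y, G β x (-y) = G β x y := by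
      intro y
      unfold G
      congr 1; ext u
      unfold F0
      rw [show (x + -y) * rr u = -((y-x) * rr u) by ring,
        show (-y - x) * rr u = -((x+y) * rr u) by ring, erf_neg, erf_neg]
      ring
    have h := deriv_comp_neg (fun y' => 1 + G β x y') 0
    simp only [hev, neg_zero] at h
    linarith
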